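/- arXiv:2210.06347 — 2 statements merged into one kernel-verified Lean document; each statement's English description precedes it below -/
import Mathlib

section
/- Let λ > 0 and m ≥ 1, and let M_m be the Ornstein–Uhlenbeck operator (1/2)Δ - λ⟨x, D⟩ on ℝ^m. For f ∈ C_b²(ℝ^m), let v(x) = ∫_0^∞ e^{-t} S_t^m f(x) dt, where S_t^m f(x) = ∫_{ℝ^m} f(e^{-λt} x + √(1 - e^{-2λt}) y) dN(0, (2λ)^{-1} I_m)(y). Then sup_{x ∈ ℝ^m} √λ |Dv(x)| ≤ (π/√2) sup_{x ∈ ℝ^m} |f(x)|, with constant independent of m and λ. -/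
open MeasureTheory Real

lemma gauss_tv {m : ℕ} (lam : ℝ) (hlam : 0 < lam)
    (hG : Integrable (fun y : EuclideanSpace ℝ (Fin m) => Real.exp (-lam * ‖y‖ ^ 2)))
    (u w : EuclideanSpace ℝ (Fin m)) :
    ∫ z : EuclideanSpace ℝ (Fin m),
      |Real.exp (-lam * ‖z - u‖ ^ 2) - Real.exp (-lam * ‖z - w‖ ^ 2)| ≤
    (Real.sqrt (2 * lam) * ‖u - w‖) *
      ∫ y : EuclideanSpace ℝ (Fin m), Real.exp (-lam * ‖y‖ ^ 2) := by
  set G := ∫ y : EuclideanSpace ℝ (Fin m), Real.exp (-lam * ‖y‖ ^ 2) with hGdef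
  have hG0 : 0 ≤ G := integral_nonneg (fun _ => (Real.exp_pos _).le)
  rcases eq_or_ne u w with rfl | huw
  · simp
  set d := ‖u - w‖ with hd
  have hdpos : 0 < d := norm_pos_iff.mpr (sub_ne_zero.mpr huw)
  set A := Real.exp (-lam * d ^ 2 / 4) with hA
  have hA0 : 0 < A := Real.exp_pos _
  have hA1 : A ≤ 1 := Real.exp_le_one_iff.mpr (by have : 0 < lam * d ^ 2 := by positivity
                                                  linarith)
  have hA2 : 1 - A ≤ lam * d ^ 2 / 4 := by
    have := Real.add_one_le_exp (-lam * d ^ 2 / 4)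
    linarith
  set s := Real.sqrt (2 * lam) with hs
  have hspos : 0 < s := Real.sqrt_pos.mpr (by linarith)
  have hs2 : s ^ 2 = 2 * lam := Real.sq_sqrt (by linarith)
  set ε := d * s / 4 with hε
  have hεpos : 0 < ε := by positivity
  set c : EuclideanSpace ℝ (Fin m) := (2⁻¹ : ℝ) • (u + w) with hc
  have hI : ∀ a : EuclideanSpace ℝ (Fin m),
      Integrable (fun z : EuclideanSpace ℝ (Fin m) => Real.exp (-lam * ‖z - a‖ ^ 2)) :=
    fun a => hG.comp_sub_right a
  have hE : ∀ a : EuclideanSpace ℝ (Fin m),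
      ∫ z : EuclideanSpace ℝ (Fin m), Real.exp (-lam * ‖z - a‖ ^ 2) = G :=
    fun a => integral_sub_right_eq_self (fun z => Real.exp (-lam * ‖z‖ ^ 2)) a
  have hpt : ∀ z : EuclideanSpace ℝ (Fin m),
      |Real.exp (-lam * ‖z - u‖ ^ 2) - Real.exp (-lam * ‖z - w‖ ^ 2)| ≤
      (1 / (2 * ε) + ε / 2) * Real.exp (-lam * ‖z - u‖ ^ 2)
      + (1 / (2 * ε) + ε / 2) * Real.exp (-lam * ‖z - w‖ ^ 2)
      + (A * (ε - 1 / ε)) * Real.exp (-lam * ‖z - c‖ ^ 2) := by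
    intro z
    have hpar : ‖z - u‖ ^ 2 + ‖z - w‖ ^ 2 = 2 * ‖z - c‖ ^ 2 + d ^ 2 / 2 := by
      have h := parallelogram_law_with_norm ℝ (z - u) (z - w)
      have e1 : (z - u) + (z - w) = (2 : ℝ) • (z - c) := by
        rw [hc]; module
      have e2 : (z - u) - (z - w) = -(u - w) := by abel
      rw [e1, e2, norm_neg, norm_smul] at h
      norm_num at h
      nlinarith [h]
    set p := Real.exp (-lam * ‖z - u‖ ^ 2) with hp
    set q := Real.exp (-lam * ‖z - w‖ ^ 2) with hq
    set r := A * Real.exp (-lam * ‖z - c‖ ^ 2) with hr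
    have hp0 : 0 < p := Real.exp_pos _
    have hq0 : 0 < q := Real.exp_pos _
    have hr0 : 0 < r := mul_pos hA0 (Real.exp_pos _)
    have hpq : p * q = r ^ 2 := by
      rw [hr, hp, hq, hA, ← Real.exp_add, ← Real.exp_add, ← Real.exp_nat_mul]
      congr 1
      push_cast
      linear_combination (-lam) * hpar
    have hrle : 0 ≤ p + q - 2 * r := by
      nlinarith [sq_nonneg (p - q)]
    have hgoal : |p - q| ≤ (p + q - 2 * r) / (2 * ε) + ε / 2 * (p + q + 2 * r) := by
      apply abs_le_of_sq_le_sq _ (by positivity)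
      have e : (p - q) ^ 2 = 4 * ((p + q - 2 * r) / (2 * ε)) * (ε / 2 * (p + q + 2 * r)) := by
        field_simp
        linear_combination (-16) * hpq
      rw [e]
      nlinarith [sq_nonneg ((p + q - 2 * r) / (2 * ε) - ε / 2 * (p + q + 2 * r))]
    refine hgoal.trans (le_of_eq ?_)
    rw [hr]
    field_simp
    ring
  have hint1 := (hI u).const_mul (1 / (2 * ε) + ε / 2)
  have hint2 := (hI w).const_mul (1 / (2 * ε) + ε / 2)
  have hint3 := (hI c).const_mul (A * (ε - 1 / ε))
  have hle := integral_mono (((hI u).sub (hI w)).abs) ((hint1.add hint2).add hint3) hpt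
  have h12 := integral_add hint1 hint2
  have h123 := integral_add (hint1.add hint2) hint3
  simp only [Pi.add_apply] at h123 hle
  rw [h123, h12, integral_const_mul, integral_const_mul, integral_const_mul, hE, hE, hE] at hle
  refine hle.trans ?_
  have : (1 / (2 * ε) + ε / 2) * G + (1 / (2 * ε) + ε / 2) * G + A * (ε - 1 / ε) * G
      = ((1 - A) / ε + ε * (1 + A)) * G := by
    field_simp
    ring
  rw [this]
  apply mul_le_mul_of_nonneg_right _ hG0
  have h1 : (1 - A) / ε ≤ s * d / 2 := by
    rw [div_le_iff₀ hεpos, hε]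
    have : s * d / 2 * (d * s / 4) = lam * d ^ 2 / 4 := by
      linear_combination (d ^ 2 / 8) * hs2
    rw [this]; exact hA2
  have h2 : ε * (1 + A) ≤ s * d / 2 := by
    rw [hε]
    nlinarith [mul_pos hdpos hspos]
  linarith

lemma kernel_int (lam : ℝ) (hlam : 0 < lam) :
    IntegrableOn (fun t => Real.exp (-lam * t) / Real.sqrt (1 - Real.exp (-2 * lam * t)))
      (Set.Ioi 0) ∧
    ∫ t in Set.Ioi (0:ℝ), Real.exp (-lam * t) / Real.sqrt (1 - Real.exp (-2 * lam * t))
      = π / (2 * lam) := by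
  have hcont : Continuous (fun t : ℝ => -(Real.arcsin (Real.exp (-lam * t))) / lam) := by
    have := Real.continuous_arcsin
    fun_prop
  have hder : ∀ t ∈ Set.Ioi (0:ℝ),
      HasDerivAt (fun t : ℝ => -(Real.arcsin (Real.exp (-lam * t))) / lam)
        (Real.exp (-lam * t) / Real.sqrt (1 - Real.exp (-2 * lam * t))) t := by
    intro t ht
    have ht' : 0 < t := ht
    have hlt : Real.exp (-lam * t) < 1 := Real.exp_lt_one_iff.mpr (by nlinarith)
    have hpos := Real.exp_pos (-lam * t)
    have h1 : HasDerivAt (fun t : ℝ => Real.exp (-lam * t)) (Real.exp (-lam * t) * (-lam * 1)) t :=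
      ((hasDerivAt_id t).const_mul (-lam)).exp
    have h2 := (Real.hasDerivAt_arcsin (x := Real.exp (-lam * t)) (by linarith) hlt.ne).comp t h1
    have h3 := h2.neg.div_const lam
    refine HasDerivAt.congr_deriv h3 ?_
    have : Real.exp (-2 * lam * t) = Real.exp (-lam * t) ^ 2 := by
      rw [← Real.exp_nat_mul]; congr 1; push_cast; ring
    rw [this]
    field_simp
  have hnn : ∀ t ∈ Set.Ioi (0:ℝ),
      0 ≤ Real.exp (-lam * t) / Real.sqrt (1 - Real.exp (-2 * lam * t)) :=
    fun t _ => by positivity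
  have hlim : Filter.Tendsto (fun t : ℝ => -(Real.arcsin (Real.exp (-lam * t))) / lam)
      Filter.atTop (nhds (-(Real.arcsin 0) / lam)) := by
    have h0 : Filter.Tendsto (fun t : ℝ => Real.exp (-lam * t)) Filter.atTop (nhds 0) := by
      apply Real.tendsto_exp_atBot.comp
      exact Filter.tendsto_id.const_mul_atTop_of_neg (by linarith)
    exact (((Real.continuous_arcsin.tendsto 0).comp h0).neg).div_const lam
  refine ⟨integrableOn_Ioi_deriv_of_nonneg hcont.continuousWithinAt hder hnn hlim, ?_⟩
  rw [integral_Ioi_of_hasDerivAt_of_nonneg hcont.continuousWithinAt hder hnn hlim]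
  simp
  field_simp

theorem stmt_12 (lam : ℝ) (hlam : 0 < lam) (m : ℕ) (hm : 1 ≤ m)
    (f : EuclideanSpace ℝ (Fin m) → ℝ)
    (hf : ContDiff ℝ 2 f)
    (hbd : ∀ i : ℕ, i ≤ 2 → ∃ M, ∀ x, ‖iteratedFDeriv ℝ i f x‖ ≤ M)
    (S : ℝ → EuclideanSpace ℝ (Fin m) → ℝ)
    (hS : ∀ t x, S t x =
      (2 * π / (2 * lam)) ^ (-(m : ℝ) / 2) *
        ∫ y : EuclideanSpace ℝ (Fin m),
          f (Real.exp (-lam * t) • x + Real.sqrt (1 - Real.exp (-2 * lam * t)) • y) *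
            Real.exp (-lam * ‖y‖ ^ 2))
    (v : EuclideanSpace ℝ (Fin m) → ℝ)
    (hv : ∀ x, v x = ∫ t in Set.Ioi (0:ℝ), Real.exp (-t) * S t x)
    (M : ℝ) (hM : ∀ x, |f x| ≤ M) :
    ∀ x, Real.sqrt lam * ‖fderiv ℝ v x‖ ≤ (π / Real.sqrt 2) * M := by
  have hfc : Continuous f := hf.continuous
  have hM0 : 0 ≤ M := (abs_nonneg _).trans (hM 0)
  set K : ℝ := (2 * π / (2 * lam)) ^ (-(m : ℝ) / 2) with hK
  have hK0 : 0 < K := Real.rpow_pos_of_pos (by positivity) _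
  set G := ∫ y : EuclideanSpace ℝ (Fin m), Real.exp (-lam * ‖y‖ ^ 2) with hGdef
  have hGv : G = (π / lam) ^ ((m : ℝ) / 2) := by
    have := GaussianFourier.integral_rexp_neg_mul_sq_norm (V := EuclideanSpace ℝ (Fin m)) hlam
    rw [hGdef, this]
    simp
  have hKG : K * G = 1 := by
    rw [hGv, hK, mul_div_mul_left _ _ (two_ne_zero), ← Real.rpow_add (by positivity)]
    rw [show -(m:ℝ)/2 + (m:ℝ)/2 = 0 by ring, Real.rpow_zero]
  have hGi : Integrable (fun y : EuclideanSpace ℝ (Fin m) => Real.exp (-lam * ‖y‖ ^ 2)) := by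
    by_contra h
    have : G = 0 := integral_undef h
    rw [this] at hKG
    simp at hKG
  have hbnd : ∀ a : EuclideanSpace ℝ (Fin m), ∀ k : ℝ, 0 ≤ k → ‖f a * k‖ ≤ M * k := by
    intro a k hk
    rw [norm_mul, Real.norm_eq_abs, Real.norm_eq_abs, abs_of_nonneg hk]
    exact mul_le_mul_of_nonneg_right (hM a) hk
  -- continuity in t
  have hScont : ∀ x, Continuous (fun t => S t x) := by
    intro x
    simp_rw [hS]
    refine continuous_const.mul ?_
    refine continuous_of_dominated (bound := fun y => M * Real.exp (-lam * ‖y‖ ^ 2)) ?_ ?_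
      (hGi.const_mul M) ?_
    · intro t
      exact Continuous.aestronglyMeasurable (by fun_prop)
    · intro t
      exact Filter.Eventually.of_forall fun y => hbnd _ _ (Real.exp_pos _).le
    · exact Filter.Eventually.of_forall fun y => by fun_prop
  have hSb : ∀ t x, ‖S t x‖ ≤ M := by
    intro t x
    rw [hS, norm_mul, Real.norm_of_nonneg hK0.le]
    have := norm_integral_le_of_norm_le (μ := volume) (hGi.const_mul M)
      (Filter.Eventually.of_forall fun y => hbnd
        (Real.exp (-lam * t) • x + Real.sqrt (1 - Real.exp (-2 * lam * t)) • y) _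
        (Real.exp_pos (-lam * ‖y‖ ^ 2)).le)
    rw [integral_const_mul] at this
    calc _ ≤ K * (M * G) := mul_le_mul_of_nonneg_left this hK0.le
      _ = M := by linear_combination M * hKG
  have hSi : ∀ x, IntegrableOn (fun t => Real.exp (-t) * S t x) (Set.Ioi 0) := by
    intro x
    refine Integrable.mono' ((integrableOn_exp_neg_Ioi 0).mul_const M) ?_ ?_
    · have := hScont x
      exact Continuous.aestronglyMeasurable (by fun_prop)
    · refine Filter.Eventually.of_forall fun t => ?_
      rw [norm_mul, Real.norm_of_nonneg (Real.exp_pos _).le]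
      exact mul_le_mul_of_nonneg_left (hSb t x) (Real.exp_pos _).le
  -- Lipschitz estimate for S
  have hSL : ∀ t, 0 < t → ∀ x x', |S t x - S t x'| ≤
      M * (Real.sqrt (2 * lam) * ((Real.exp (-lam * t) /
        Real.sqrt (1 - Real.exp (-2 * lam * t))) * ‖x - x'‖)) := by
    intro t ht x x'
    set a := Real.exp (-lam * t) with ha
    set b := Real.sqrt (1 - Real.exp (-2 * lam * t)) with hb
    have hb0 : 0 < b := Real.sqrt_pos.mpr (by
      have : Real.exp (-2 * lam * t) < 1 := Real.exp_lt_one_iff.mpr (by nlinarith [mul_pos hlam ht])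
      linarith)
    have ha0 : 0 < a := Real.exp_pos _
    have hrep : ∀ x, S t x = K * ∫ z : EuclideanSpace ℝ (Fin m),
        f (b • z) * Real.exp (-lam * ‖z - (a / b) • x‖ ^ 2) := by
      intro x
      rw [hS, ← integral_sub_right_eq_self (fun y : EuclideanSpace ℝ (Fin m) =>
        f (a • x + b • y) * Real.exp (-lam * ‖y‖ ^ 2)) ((a / b) • x)]
      congr 1
      refine integral_congr_ae (Filter.Eventually.of_forall fun z => ?_)
      have : a • x + b • (z - (a / b) • x) = b • z := by
        rw [smul_sub, smul_smul, mul_div_cancel₀ _ hb0.ne']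
        abel
      simp only [this]
    have hI : ∀ c : EuclideanSpace ℝ (Fin m), Integrable (fun z : EuclideanSpace ℝ (Fin m) =>
        Real.exp (-lam * ‖z - c‖ ^ 2)) := fun c => hGi.comp_sub_right c
    have hI2 : ∀ c : EuclideanSpace ℝ (Fin m), Integrable (fun z : EuclideanSpace ℝ (Fin m) =>
        f (b • z) * Real.exp (-lam * ‖z - c‖ ^ 2)) := by
      intro c
      refine Integrable.mono' ((hI c).const_mul M)
        (Continuous.aestronglyMeasurable (by fun_prop)) ?_
      exact Filter.Eventually.of_forall fun y => hbnd _ _ (Real.exp_pos _).le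
    rw [hrep, hrep, ← mul_sub, ← integral_sub (hI2 _) (hI2 _), abs_mul, abs_of_pos hK0]
    have h1 := norm_integral_le_of_norm_le (μ := volume)
      (f := fun z : EuclideanSpace ℝ (Fin m) =>
        f (b • z) * Real.exp (-lam * ‖z - (a / b) • x‖ ^ 2)
        - f (b • z) * Real.exp (-lam * ‖z - (a / b) • x'‖ ^ 2))
      ((((hI ((a / b) • x)).sub (hI ((a / b) • x'))).abs).const_mul M)
      (Filter.Eventually.of_forall fun z => by
        rw [← mul_sub, norm_mul, Real.norm_eq_abs, Real.norm_eq_abs]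
        exact mul_le_mul_of_nonneg_right (hM _) (abs_nonneg _))
    rw [integral_const_mul, Real.norm_eq_abs] at h1
    have h2 := gauss_tv lam hlam hGi ((a / b) • x) ((a / b) • x')
    rw [← smul_sub, norm_smul, Real.norm_of_nonneg (by positivity)] at h2
    have h3 := h1.trans (mul_le_mul_of_nonneg_left h2 hM0)
    refine (mul_le_mul_of_nonneg_left h3 hK0.le).trans (le_of_eq ?_)
    linear_combination (M * (Real.sqrt (2 * lam) * (a / b * ‖x - x'‖))) * hKG
  obtain ⟨hki, hkv⟩ := kernel_int lam hlam
  have hvL : ∀ x x', ‖v x - v x'‖ ≤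
      (M * Real.sqrt (2 * lam) * (π / (2 * lam))) * ‖x - x'‖ := by
    intro x x'
    rw [hv, hv, ← integral_sub (hSi x) (hSi x')]
    have hb := norm_integral_le_of_norm_le (μ := volume.restrict (Set.Ioi (0:ℝ)))
      (f := fun t => Real.exp (-t) * S t x - Real.exp (-t) * S t x')
      (hki.const_mul (M * Real.sqrt (2 * lam) * ‖x - x'‖))
      ((ae_restrict_iff' measurableSet_Ioi).mpr (Filter.Eventually.of_forall fun t ht => by
        have ht' : 0 < t := ht
        rw [← mul_sub, norm_mul, Real.norm_of_nonneg (Real.exp_pos _).le, Real.norm_eq_abs]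
        have h1 : Real.exp (-t) ≤ 1 := Real.exp_le_one_iff.mpr (by linarith)
        calc _ ≤ 1 * |S t x - S t x'| := mul_le_mul_of_nonneg_right h1 (abs_nonneg _)
          _ ≤ _ := by
            rw [one_mul]
            refine (hSL t ht' x x').trans (le_of_eq (by ring))))
    rw [integral_const_mul, hkv] at hb
    exact hb.trans (le_of_eq (by ring))
  intro x
  have hfd : ‖fderiv ℝ v x‖ ≤ M * Real.sqrt (2 * lam) * (π / (2 * lam)) :=
    norm_fderiv_le_of_lip' ℝ (by positivity) (Filter.Eventually.of_forall fun y => hvL y x)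
  refine (mul_le_mul_of_nonneg_left hfd (Real.sqrt_nonneg _)).trans (le_of_eq ?_)
  have hsl : Real.sqrt lam ^ 2 = lam := Real.sq_sqrt hlam.le
  have hs2 : Real.sqrt 2 ^ 2 = 2 := Real.sq_sqrt (by norm_num)
  rw [Real.sqrt_mul (by norm_num)]
  field_simp
  rw [hsl, hs2]
  try ring
end

section
/- Let λ > 0, m ≥ 1, h ∈ ℝ^m with |h| = 1, and f ∈ C_b²(ℝ^m). Define u(x) = ∫_0^∞ e^{-t/λ} dt ∫_{ℝ^m} f̃(e^{-t} x + y) dN(0, ((1-e^{-2t})/2) I_m)(dy) with f̃ = λ^{-1} f(·/√λ). Then the directional derivative satisfies D_h u(x) = 2∫_0^∞ e^{-t/λ} ∫_{ℝ^m} f̃(e^{-t}x + y) (e^{-t}/(1-e^{-2t})) ⟨h,y⟩ dN(0, ((1-e^{-2t})/2) I_m)(dy) dt, and ‖D_h u‖_∞ ≤ (π/(λ√2)) ‖f‖_∞. -/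
open MeasureTheory Real
open scoped RealInnerProductSpace

lemma aux_gint {m : ℕ} {s : ℝ} (hs : 0 < s) :
    Integrable (fun y : EuclideanSpace ℝ (Fin m) => Real.exp (-‖y‖ ^ 2 / s)) := by
  have h1 := GaussianFourier.integrable_cexp_neg_mul_sq_norm_add
    (V := EuclideanSpace ℝ (Fin m)) (b := ((1 / s : ℝ) : ℂ))
    (by simpa using hs) 0 0
  have h2 := h1.re
  refine h2.congr (Filter.Eventually.of_forall fun y => ?_)
  have : (-((1 / s : ℝ) : ℂ) * (‖y‖ : ℂ) ^ 2 + 0 * ((⟪(0 : EuclideanSpace ℝ (Fin m)), y⟫ : ℝ) : ℂ))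
      = ((-‖y‖ ^ 2 / s : ℝ) : ℂ) := by
    push_cast; ring
  simp only [this]
  rw [← Complex.ofReal_exp]
  exact Complex.ofReal_re _

lemma aux_gnorm {m : ℕ} {s : ℝ} (hs : 0 < s) :
    (π * s) ^ (-(m : ℝ) / 2) *
      ∫ y : EuclideanSpace ℝ (Fin m), Real.exp (-‖y‖ ^ 2 / s) = 1 := by
  have h1 := GaussianFourier.integral_rexp_neg_mul_sq_norm
    (V := EuclideanSpace ℝ (Fin m)) (b := 1 / s) (by positivity)
  have : (fun y : EuclideanSpace ℝ (Fin m) => Real.exp (-‖y‖ ^ 2 / s))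
      = fun y => Real.exp (-(1 / s) * ‖y‖ ^ 2) := by
    ext y; congr 1; ring
  rw [this, h1, finrank_euclideanSpace_fin]
  have h2 : π / (1 / s) = π * s := by field_simp
  rw [h2, ← Real.rpow_add (by positivity)]
  have : -(m : ℝ) / 2 + m / 2 = 0 := by ring
  rw [this, Real.rpow_zero]

lemma aux_gint2 {m : ℕ} {s : ℝ} (hs : 0 < s) :
    Integrable (fun y : EuclideanSpace ℝ (Fin m) => ‖y‖ ^ 2 * Real.exp (-‖y‖ ^ 2 / s)) := by
  have h1 := (aux_gint (m := m) (s := 2 * s) (by positivity)).const_mul (2 * s)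
  refine h1.mono' ?_ (Filter.Eventually.of_forall fun y => ?_)
  · exact Continuous.aestronglyMeasurable (by fun_prop)
  · rw [Real.norm_of_nonneg (by positivity)]
    have h3 : Real.exp (-‖y‖ ^ 2 / s) =
        Real.exp (-‖y‖ ^ 2 / (2 * s)) * Real.exp (-‖y‖ ^ 2 / (2 * s)) := by
      rw [← Real.exp_add]; congr 1; field_simp; norm_num
    have h4 : ‖y‖ ^ 2 * Real.exp (-‖y‖ ^ 2 / (2 * s)) ≤ 2 * s := by
      have h5 := Real.add_one_le_exp (‖y‖ ^ 2 / (2 * s))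
      have h6 : -‖y‖ ^ 2 / (2 * s) = -(‖y‖ ^ 2 / (2 * s)) := by ring
      rw [h6, Real.exp_neg, ← div_eq_mul_inv, div_le_iff₀ (Real.exp_pos _)]
      have h7 : ‖y‖ ^ 2 = 2 * s * (‖y‖ ^ 2 / (2 * s)) := by field_simp
      nlinarith
    rw [h3, ← mul_assoc]
    exact mul_le_mul_of_nonneg_right h4 (Real.exp_pos _).le

lemma aux_wint {m : ℕ} {s : ℝ} (hs : 0 < s) {G : Type*} [NormedAddCommGroup G] [NormedSpace ℝ G]
    (v : EuclideanSpace ℝ (Fin m) → G) (hv : Continuous v) (A B : ℝ)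
    (hb : ∀ y, ‖v y‖ ≤ A + B * ‖y‖ ^ 2) :
    Integrable (fun y => Real.exp (-‖y‖ ^ 2 / s) • v y) := by
  have h1 := ((aux_gint (m := m) hs).const_mul A).add ((aux_gint2 (m := m) hs).const_mul B)
  refine h1.mono' ?_ (Filter.Eventually.of_forall fun y => ?_)
  · exact Continuous.aestronglyMeasurable (by fun_prop)
  · rw [norm_smul, Real.norm_of_nonneg (by positivity)]
    have := mul_le_mul_of_nonneg_left (hb y) (Real.exp_pos (-‖y‖ ^ 2 / s)).le
    simp only [Pi.add_apply]
    linarith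

lemma aux_inner_sq_le {m : ℕ} (h y : EuclideanSpace ℝ (Fin m)) (hh : ‖h‖ = 1) :
    |⟪h, y⟫| ≤ ‖y‖ := by
  have := abs_real_inner_le_norm h y
  rwa [hh, one_mul] at this

lemma aux_ibp {m : ℕ} {s : ℝ} (hs : 0 < s) (h : EuclideanSpace ℝ (Fin m)) (hh : ‖h‖ = 1)
    (v : EuclideanSpace ℝ (Fin m) → ℝ) (hv : ContDiff ℝ 1 v) (A C : ℝ)
    (hA : ∀ y, |v y| ≤ A + A * ‖y‖) (hC : ∀ y, ‖fderiv ℝ v y‖ ≤ C) :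
    ∫ y, fderiv ℝ v y h * Real.exp (-‖y‖ ^ 2 / s) =
      ∫ y, v y * (2 / s * ⟪h, y⟫) * Real.exp (-‖y‖ ^ 2 / s) := by
  have hA0 : 0 ≤ A := by have := (abs_nonneg _).trans (hA 0); simpa using this
  have hvd : Continuous (fun y => fderiv ℝ v y h) :=
    (hv.continuous_fderiv one_ne_zero).clm_apply continuous_const
  have hvc := hv.continuous
  have hg : ∀ y : EuclideanSpace ℝ (Fin m), HasFDerivAt (fun y => Real.exp (-‖y‖ ^ 2 / s))
      (Real.exp (-‖y‖ ^ 2 / s) • (s⁻¹ • -((2:ℕ) • innerSL ℝ y : EuclideanSpace ℝ (Fin m) →L[ℝ] ℝ))) y := by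
    intro y
    have h1 : HasFDerivAt (fun y : EuclideanSpace ℝ (Fin m) => ‖y‖ ^ 2) (2 • innerSL ℝ y) y :=
      (hasStrictFDerivAt_norm_sq y).hasFDerivAt
    have h2 := (h1.neg.const_mul s⁻¹).exp
    have e : (fun y : EuclideanSpace ℝ (Fin m) => Real.exp (-‖y‖ ^ 2 / s)) =
      fun y => Real.exp (s⁻¹ * (-‖y‖ ^ 2)) := by
      ext y; congr 1; ring
    rw [e]
    have e2 : -‖y‖ ^ 2 / s = s⁻¹ * (-‖y‖ ^ 2) := by ring
    rw [e2]
    exact h2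
  have hg' : ∀ y : EuclideanSpace ℝ (Fin m), fderiv ℝ (fun y => Real.exp (-‖y‖ ^ 2 / s)) y h =
      -((2 / s * ⟪h, y⟫) * Real.exp (-‖y‖ ^ 2 / s)) := by
    intro y
    rw [(hg y).fderiv]
    simp [real_inner_comm]
    ring
  have hy1 : ∀ y : EuclideanSpace ℝ (Fin m), ‖y‖ ≤ 1 + ‖y‖ ^ 2 := fun y => by
    nlinarith [sq_nonneg (‖y‖ - 1 / 2)]
  have key := integral_mul_fderiv_eq_neg_fderiv_mul_of_integrable
    (μ := (volume : Measure (EuclideanSpace ℝ (Fin m)))) (f := v)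
    (g := fun y => Real.exp (-‖y‖ ^ 2 / s)) (v := h) ?_ ?_ ?_
    (fun y _ => (hv.differentiable one_ne_zero) y) (fun y _ => (hg y).differentiableAt)
  · simp only [hg'] at key
    rw [eq_comm, neg_eq_iff_eq_neg] at key
    rw [key, ← integral_neg]
    congr 1; ext y; ring
  · have := aux_wint hs _ hvd C 0 (fun y => by
      have := (fderiv ℝ v y).le_opNorm h
      rw [hh] at this
      linarith [hC y])
    simpa [mul_comm] using this
  · simp only [hg']
    have := aux_wint hs (fun y => v y * -(2 / s * ⟪h, y⟫)) (by fun_prop) (2 / s * A) (2 / s * (2 * A))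
      (fun y => by
        rw [norm_mul, norm_neg, norm_mul, Real.norm_of_nonneg (by positivity : 0 ≤ 2 / s)]
        have h1 := aux_inner_sq_le h y hh
        have h2 := hA y
        have h3 : |v y| * |⟪h, y⟫| ≤ (A + A * ‖y‖) * ‖y‖ :=
          mul_le_mul h2 h1 (abs_nonneg _) ((abs_nonneg _).trans h2)
        have h4 : (A + A * ‖y‖) * ‖y‖ ≤ A + 2 * A * ‖y‖ ^ 2 := by
          nlinarith [mul_le_mul_of_nonneg_left (hy1 y) hA0]
        have h5 := mul_le_mul_of_nonneg_left (h3.trans h4) (by positivity : 0 ≤ 2 / s)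
        simp only [Real.norm_eq_abs]
        linarith)
    refine this.congr (Filter.Eventually.of_forall fun y => ?_)
    simp only [smul_eq_mul]; ring
  · have := aux_wint hs v hvc (2 * A) A (fun y => by
      have := mul_le_mul_of_nonneg_left (hy1 y) hA0
      rw [Real.norm_eq_abs]
      linarith [hA y])
    simpa [mul_comm] using this

lemma aux_abs {m : ℕ} {s : ℝ} (hs : 0 < s) (h : EuclideanSpace ℝ (Fin m)) (hh : ‖h‖ = 1) :
    (π * s) ^ (-(m : ℝ) / 2) *
      ∫ y : EuclideanSpace ℝ (Fin m), |⟪h, y⟫| * Real.exp (-‖y‖ ^ 2 / s) ≤ √(s / 2) := by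
  have h1 := aux_ibp hs h hh (fun y => ⟪h, y⟫) (contDiff_const.inner ℝ contDiff_id) 1 1
    (fun y => by have := aux_inner_sq_le h y hh; linarith)
    (fun y => by
      have : HasFDerivAt (fun y => ⟪h, y⟫) (innerSL ℝ h) y := (innerSL ℝ h).hasFDerivAt
      rw [this.fderiv, innerSL_apply_norm, hh])
  have h2 : ∀ y, fderiv ℝ (fun y => ⟪h, y⟫) y h = 1 := fun y => by
    have : HasFDerivAt (fun y => ⟪h, y⟫) (innerSL ℝ h) y := (innerSL ℝ h).hasFDerivAt
    rw [this.fderiv, innerSL_apply_apply, real_inner_self_eq_norm_sq, hh, one_pow]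
  simp only [h2, one_mul] at h1
  set σ := √(s / 2) with hσ
  have hσ0 : 0 < σ := Real.sqrt_pos.2 (by positivity)
  have hσ2 : σ ^ 2 = s / 2 := Real.sq_sqrt (by positivity)
  set c := (π * s) ^ (-(m : ℝ) / 2) with hc
  have hc0 : 0 ≤ c := by positivity
  have hn : c * _ = 1 := aux_gnorm (m := m) hs
  have i0 := aux_gint (m := m) hs
  have i2 : Integrable (fun y : EuclideanSpace ℝ (Fin m) =>
      ⟪h, y⟫ * (2 / s * ⟪h, y⟫) * Real.exp (-‖y‖ ^ 2 / s)) := by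
    have := aux_wint hs (fun y => ⟪h, y⟫ * (2 / s * ⟪h, y⟫)) (by fun_prop) 0 (2 / s) (fun y => by
      have h1 := aux_inner_sq_le h y hh
      have h3 : ⟪h, y⟫ * (2 / s * ⟪h, y⟫) = 2 / s * |⟪h, y⟫| ^ 2 := by rw [sq_abs]; ring
      rw [h3, Real.norm_of_nonneg (by positivity), zero_add]
      gcongr)
    simpa [mul_comm] using this
  have h3 : ∫ y : EuclideanSpace ℝ (Fin m), |⟪h, y⟫| * Real.exp (-‖y‖ ^ 2 / s) ≤
      ∫ y : EuclideanSpace ℝ (Fin m), (σ / 2 * (⟪h, y⟫ * (2 / s * ⟪h, y⟫) * Real.exp (-‖y‖ ^ 2 / s))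
        + σ / 2 * Real.exp (-‖y‖ ^ 2 / s)) := by
    apply integral_mono_of_nonneg
    · exact Filter.Eventually.of_forall fun y => by positivity
    · exact (i2.const_mul _).add (i0.const_mul _)
    · refine Filter.Eventually.of_forall fun y => ?_
      have e : σ / 2 * (⟪h, y⟫ * (2 / s * ⟪h, y⟫) * Real.exp (-‖y‖ ^ 2 / s))
        + σ / 2 * Real.exp (-‖y‖ ^ 2 / s) =
          (σ / 2 * (2 / s) * |⟪h, y⟫| ^ 2 + σ / 2) * Real.exp (-‖y‖ ^ 2 / s) := by
        rw [sq_abs]; ring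
      simp only [e]
      apply mul_le_mul_of_nonneg_right _ (Real.exp_pos _).le
      have hs2 : 2 / s = 1 / σ ^ 2 := by rw [hσ2]; field_simp
      rw [hs2]
      have : σ / 2 * (1 / σ ^ 2) * |⟪h, y⟫| ^ 2 + σ / 2 - |⟪h, y⟫|
        = (|⟪h, y⟫| - σ) ^ 2 / (2 * σ) := by field_simp; ring
      have : 0 ≤ (|⟪h, y⟫| - σ) ^ 2 / (2 * σ) := by positivity
      linarith
  rw [integral_add (i2.const_mul _) (i0.const_mul _), integral_const_mul, integral_const_mul,
    ← h1] at h3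
  have := mul_le_mul_of_nonneg_left h3 hc0
  calc _ ≤ _ := this
    _ = σ * (c * ∫ y : EuclideanSpace ℝ (Fin m), Real.exp (-‖y‖ ^ 2 / s)) := by ring
    _ = σ := by rw [hn, mul_one]

lemma aux_spos {t : ℝ} (ht : 0 < t) : 0 < 1 - Real.exp (-2 * t) := by
  have : Real.exp (-2 * t) < 1 := Real.exp_lt_one_iff.2 (by linarith)
  linarith

lemma aux_arcsin : IntegrableOn (fun t : ℝ => Real.exp (-t) / √(1 - Real.exp (-2 * t))) (Set.Ioi 0)
    ∧ ∫ t in Set.Ioi (0:ℝ), Real.exp (-t) / √(1 - Real.exp (-2 * t)) = π / 2 := by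
  have hc : ContinuousWithinAt (fun t : ℝ => - Real.arcsin (Real.exp (-t))) (Set.Ici 0) 0 := by
    apply Continuous.continuousWithinAt
    exact (Real.continuous_arcsin.comp (by fun_prop)).neg
  have hd : ∀ t ∈ Set.Ioi (0:ℝ), HasDerivAt (fun t : ℝ => - Real.arcsin (Real.exp (-t)))
      (Real.exp (-t) / √(1 - Real.exp (-2 * t))) t := by
    intro t ht
    have ht : 0 < t := ht
    have h1 : HasDerivAt (fun t : ℝ => Real.exp (-t)) (Real.exp (-t) * (-1)) t :=
      (hasDerivAt_neg t).exp
    have h2 := (Real.hasDerivAt_arcsin (x := Real.exp (-t))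
      (by have := Real.exp_pos (-t); linarith)
      (Real.exp_lt_one_iff.2 (by linarith)).ne).comp t h1
    have : Real.exp (-2 * t) = Real.exp (-t) ^ 2 := by
      rw [← Real.exp_nat_mul]; congr 1; push_cast; ring
    have e : Real.exp (-t) / √(1 - Real.exp (-2 * t)) =
      -(1 / √(1 - Real.exp (-t) ^ 2) * (Real.exp (-t) * -1)) := by rw [this]; ring
    rw [e]
    exact h2.neg
  have hp : ∀ t ∈ Set.Ioi (0:ℝ), 0 ≤ Real.exp (-t) / √(1 - Real.exp (-2 * t)) :=
    fun t _ => by positivity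
  have hl : Filter.Tendsto (fun t : ℝ => - Real.arcsin (Real.exp (-t))) Filter.atTop (nhds 0) := by
    have h1 : Filter.Tendsto (fun t : ℝ => Real.exp (-t)) Filter.atTop (nhds 0) :=
      Real.tendsto_exp_neg_atTop_nhds_zero
    have h2 := ((Real.continuous_arcsin.tendsto 0).comp h1).neg
    simpa using h2
  refine ⟨integrableOn_Ioi_deriv_of_nonneg hc hd hp hl, ?_⟩
  rw [integral_Ioi_of_hasDerivAt_of_nonneg hc hd hp hl]
  simp

lemma aux_expint {lam : ℝ} (hlam : 0 < lam) :
    IntegrableOn (fun t : ℝ => Real.exp (-t / lam)) (Set.Ioi 0) := by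
  have := integrableOn_exp_mul_Ioi (a := -(1 / lam)) (by simpa using hlam) 0
  refine this.congr_fun (fun t _ => ?_) measurableSet_Ioi
  simp only; congr 1; ring

/-- inner derivative -/
lemma aux_inner_deriv {m : ℕ} {s : ℝ} (hs : 0 < s) (a : ℝ)
    (F : EuclideanSpace ℝ (Fin m) → ℝ) (hF : ContDiff ℝ 1 F) (K C : ℝ)
    (hK : ∀ y, |F y| ≤ K) (hC : ∀ y, ‖fderiv ℝ F y‖ ≤ C) (x : EuclideanSpace ℝ (Fin m)) :
    HasFDerivAt (fun x => ∫ y, F (a • x + y) * Real.exp (-‖y‖ ^ 2 / s))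
      (∫ y, Real.exp (-‖y‖ ^ 2 / s) • (a • fderiv ℝ F (a • x + y))) x := by
  have hFc := hF.continuous
  have hFd := hF.continuous_fderiv one_ne_zero
  apply hasFDerivAt_integral_of_dominated_of_fderiv_le
    (F := fun x y => F (a • x + y) * Real.exp (-‖y‖ ^ 2 / s))
    (F' := fun x y => Real.exp (-‖y‖ ^ 2 / s) • (a • fderiv ℝ F (a • x + y)))
    (bound := fun y => Real.exp (-‖y‖ ^ 2 / s) * (|a| * C)) Filter.univ_mem
  · exact Filter.Eventually.of_forall fun x => Continuous.aestronglyMeasurable (by fun_prop)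
  · have := aux_wint hs (fun y => F (a • x + y)) (by fun_prop) K 0 (fun y => by
      simpa using hK (a • x + y))
    simpa [mul_comm] using this
  · exact Continuous.aestronglyMeasurable (by fun_prop)
  · refine Filter.Eventually.of_forall fun y x _ => ?_
    rw [norm_smul, norm_smul, Real.norm_of_nonneg (Real.exp_pos _).le, Real.norm_eq_abs]
    gcongr
    exact hC _
  · exact (aux_gint hs).mul_const _
  · refine Filter.Eventually.of_forall fun y x _ => ?_
    have h1 : HasFDerivAt (fun x : EuclideanSpace ℝ (Fin m) => a • x + y)
        (a • ContinuousLinearMap.id ℝ _) x := ((hasFDerivAt_id x).const_smul a).add_const y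
    have h2 := ((hF.differentiable one_ne_zero (a • x + y)).hasFDerivAt.comp x h1).mul_const
      (Real.exp (-‖y‖ ^ 2 / s))
    have e : Real.exp (-‖y‖ ^ 2 / s) • (a • fderiv ℝ F (a • x + y)) = Real.exp (-‖y‖ ^ 2 / s) •
        (fderiv ℝ F (a • x + y)).comp (a • ContinuousLinearMap.id ℝ (EuclideanSpace ℝ (Fin m))) := by
      ext z; simp
    rw [e]
    exact h2

lemma aux_inner_bound {m : ℕ} {s : ℝ} (hs : 0 < s) (a : ℝ) (ha : |a| ≤ 1) (C : ℝ)
    {G : Type*} [NormedAddCommGroup G] [NormedSpace ℝ G]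
    (V : EuclideanSpace ℝ (Fin m) → G) (hC : ∀ y, ‖V y‖ ≤ C) :
    ‖(π * s) ^ (-(m : ℝ) / 2) • ∫ y : EuclideanSpace ℝ (Fin m),
      Real.exp (-‖y‖ ^ 2 / s) • (a • V y)‖ ≤ C := by
  have hC0 : 0 ≤ C := (norm_nonneg _).trans (hC 0)
  rw [norm_smul, Real.norm_of_nonneg (by positivity)]
  have h1 : ‖∫ y : EuclideanSpace ℝ (Fin m), Real.exp (-‖y‖ ^ 2 / s) • (a • V y)‖ ≤
      ∫ y : EuclideanSpace ℝ (Fin m), Real.exp (-‖y‖ ^ 2 / s) * C := by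
    apply norm_integral_le_of_norm_le ((aux_gint hs).mul_const _)
    refine Filter.Eventually.of_forall fun y => ?_
    rw [norm_smul, norm_smul, Real.norm_of_nonneg (Real.exp_pos _).le, Real.norm_eq_abs]
    gcongr
    calc |a| * ‖V y‖ ≤ 1 * C := mul_le_mul ha (hC y) (norm_nonneg _) zero_le_one
      _ = C := one_mul C
  rw [integral_mul_const] at h1
  calc _ ≤ (π * s) ^ (-(m : ℝ) / 2) * ((∫ y : EuclideanSpace ℝ (Fin m), Real.exp (-‖y‖ ^ 2 / s)) * C) := by gcongr
    _ = C := by rw [← mul_assoc, aux_gnorm hs, one_mul]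

lemma aux_meas {m : ℕ} {G : Type*} [NormedAddCommGroup G] [NormedSpace ℝ G]
    (V : ℝ → EuclideanSpace ℝ (Fin m) → G) (hV : Continuous (Function.uncurry V)) (lam : ℝ) :
    StronglyMeasurable (fun t : ℝ => Real.exp (-t / lam) •
      ((π * (1 - Real.exp (-2 * t))) ^ (-(m : ℝ) / 2) •
        ∫ y : EuclideanSpace ℝ (Fin m), Real.exp (-‖y‖ ^ 2 / (1 - Real.exp (-2 * t))) • V t y)) := by
  apply StronglyMeasurable.smul
  · exact Measurable.stronglyMeasurable (by fun_prop)
  apply StronglyMeasurable.smul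
  · exact Measurable.stronglyMeasurable (by fun_prop)
  apply StronglyMeasurable.integral_prod_right
    (f := fun (t : ℝ) (y : EuclideanSpace ℝ (Fin m)) => Real.exp (-‖y‖ ^ 2 / (1 - Real.exp (-2 * t))) • V t y)
  apply StronglyMeasurable.smul
  · exact Measurable.stronglyMeasurable (by fun_prop)
  · exact hV.stronglyMeasurable

lemma aux_main {lam : ℝ} (hlam : 0 < lam) {m : ℕ}
    (h : EuclideanSpace ℝ (Fin m)) (hh : ‖h‖ = 1)
    (ftil : EuclideanSpace ℝ (Fin m) → ℝ)
    (hF : ContDiff ℝ 1 ftil) {M : ℝ} (C : ℝ) (hK : ∀ y, |ftil y| ≤ lam⁻¹ * M)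
    (hC : ∀ y, ‖fderiv ℝ ftil y‖ ≤ C)
    (u : EuclideanSpace ℝ (Fin m) → ℝ)
    (hu : ∀ x, u x = ∫ t in Set.Ioi (0:ℝ),
      Real.exp (-t / lam) *
        ((π * (1 - Real.exp (-2 * t))) ^ (-(m : ℝ) / 2) *
          ∫ y : EuclideanSpace ℝ (Fin m),
            ftil (Real.exp (-t) • x + y) *
              Real.exp (-‖y‖ ^ 2 / (1 - Real.exp (-2 * t)))))
    (hM0 : 0 ≤ M) :
    (∀ x, fderiv ℝ u x h =
      2 * ∫ t in Set.Ioi (0:ℝ),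
        Real.exp (-t / lam) *
          ((π * (1 - Real.exp (-2 * t))) ^ (-(m : ℝ) / 2) *
            ∫ y : EuclideanSpace ℝ (Fin m),
              ftil (Real.exp (-t) • x + y) *
                (Real.exp (-t) / (1 - Real.exp (-2 * t))) * ⟪h, y⟫ *
                  Real.exp (-‖y‖ ^ 2 / (1 - Real.exp (-2 * t)))))
    ∧ ∀ x, |fderiv ℝ u x h| ≤ (π / (lam * Real.sqrt 2)) * M := by
  have hFc := hF.continuous
  have hFd := hF.continuous_fderiv one_ne_zero
  have hKn : 0 ≤ lam⁻¹ * M := by positivity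
  have hexp1 : ∀ t : ℝ, 0 < t → |Real.exp (-t)| ≤ 1 := fun t ht => by
    rw [abs_of_pos (Real.exp_pos _)]; exact Real.exp_le_one_iff.2 (by linarith)
  have hm1 : ∀ x, AEStronglyMeasurable (fun t : ℝ => Real.exp (-t / lam) *
        ((π * (1 - Real.exp (-2 * t))) ^ (-(m : ℝ) / 2) *
          ∫ y : EuclideanSpace ℝ (Fin m),
            ftil (Real.exp (-t) • x + y) *
              Real.exp (-‖y‖ ^ 2 / (1 - Real.exp (-2 * t))))) (volume.restrict (Set.Ioi 0)) := by
    intro x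
    have := (aux_meas (m := m) (fun t y => ftil (Real.exp (-t) • x + y))
      (by simp only [Function.uncurry_def]; fun_prop) lam).aestronglyMeasurable
        (μ := volume.restrict (Set.Ioi 0))
    simp only [smul_eq_mul] at this
    simpa only [mul_comm (ftil _)] using this
  have hm2 : ∀ x, AEStronglyMeasurable (fun t : ℝ => Real.exp (-t / lam) •
        ((π * (1 - Real.exp (-2 * t))) ^ (-(m : ℝ) / 2) •
          ∫ y : EuclideanSpace ℝ (Fin m), Real.exp (-‖y‖ ^ 2 / (1 - Real.exp (-2 * t))) •
            (Real.exp (-t) • fderiv ℝ ftil (Real.exp (-t) • x + y))))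
            (volume.restrict (Set.Ioi 0)) := by
    intro x
    exact (aux_meas (m := m) (fun t y => Real.exp (-t) • fderiv ℝ ftil (Real.exp (-t) • x + y))
      (by simp only [Function.uncurry_def]; fun_prop) lam).aestronglyMeasurable
  have hb2 : ∀ x, ∀ t : ℝ, 0 < t → ‖Real.exp (-t / lam) •
        ((π * (1 - Real.exp (-2 * t))) ^ (-(m : ℝ) / 2) •
          ∫ y : EuclideanSpace ℝ (Fin m), Real.exp (-‖y‖ ^ 2 / (1 - Real.exp (-2 * t))) •
            (Real.exp (-t) • fderiv ℝ ftil (Real.exp (-t) • x + y)))‖ ≤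
        Real.exp (-t / lam) * C := by
    intro x t ht
    rw [norm_smul, Real.norm_of_nonneg (Real.exp_pos _).le]
    gcongr
    exact aux_inner_bound (aux_spos ht) _ (hexp1 t ht) C _ (fun y => hC _)
  have hI2 : ∀ x, Integrable (fun t : ℝ => Real.exp (-t / lam) •
        ((π * (1 - Real.exp (-2 * t))) ^ (-(m : ℝ) / 2) •
          ∫ y : EuclideanSpace ℝ (Fin m), Real.exp (-‖y‖ ^ 2 / (1 - Real.exp (-2 * t))) •
            (Real.exp (-t) • fderiv ℝ ftil (Real.exp (-t) • x + y))))
            (volume.restrict (Set.Ioi 0)) := fun x =>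
    Integrable.mono' ((aux_expint hlam).mul_const C) (hm2 x)
      ((ae_restrict_iff' measurableSet_Ioi).2 (Filter.Eventually.of_forall fun t ht => hb2 x t ht))
  have hder : ∀ x, HasFDerivAt u (∫ t in Set.Ioi (0:ℝ), Real.exp (-t / lam) •
        ((π * (1 - Real.exp (-2 * t))) ^ (-(m : ℝ) / 2) •
          ∫ y : EuclideanSpace ℝ (Fin m), Real.exp (-‖y‖ ^ 2 / (1 - Real.exp (-2 * t))) •
            (Real.exp (-t) • fderiv ℝ ftil (Real.exp (-t) • x + y)))) x := by
    intro x
    rw [funext hu]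
    apply hasFDerivAt_integral_of_dominated_of_fderiv_le
      (F := fun x t => Real.exp (-t / lam) *
        ((π * (1 - Real.exp (-2 * t))) ^ (-(m : ℝ) / 2) *
          ∫ y : EuclideanSpace ℝ (Fin m),
            ftil (Real.exp (-t) • x + y) *
              Real.exp (-‖y‖ ^ 2 / (1 - Real.exp (-2 * t)))))
      (F' := fun x t => Real.exp (-t / lam) •
        ((π * (1 - Real.exp (-2 * t))) ^ (-(m : ℝ) / 2) •
          ∫ y : EuclideanSpace ℝ (Fin m), Real.exp (-‖y‖ ^ 2 / (1 - Real.exp (-2 * t))) •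
            (Real.exp (-t) • fderiv ℝ ftil (Real.exp (-t) • x + y))))
      (bound := fun t => Real.exp (-t / lam) * C) Filter.univ_mem
    · exact Filter.Eventually.of_forall hm1
    · refine Integrable.mono' ((aux_expint hlam).mul_const (lam⁻¹ * M)) (hm1 x)
        ((ae_restrict_iff' measurableSet_Ioi).2 (Filter.Eventually.of_forall fun t ht => ?_))
      rw [norm_mul, Real.norm_of_nonneg (Real.exp_pos _).le]
      gcongr
      have := aux_inner_bound (m := m) (aux_spos ht) 1 (by simp) (lam⁻¹ * M)
        (fun y => ftil (Real.exp (-t) • x + y)) (fun y => hK _)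
      simp only [smul_eq_mul, one_mul] at this
      simpa only [mul_comm (ftil _)] using this
    · exact hm2 x
    · exact (ae_restrict_iff' measurableSet_Ioi).2
        (Filter.Eventually.of_forall fun t ht x _ => hb2 x t ht)
    · exact (aux_expint hlam).mul_const C
    · refine (ae_restrict_iff' measurableSet_Ioi).2
        (Filter.Eventually.of_forall fun t ht x _ => ?_)
      have := aux_inner_deriv (aux_spos ht) (Real.exp (-t)) ftil hF _ C hK hC x
      exact (this.const_mul _).const_mul _
  have hform : ∀ x, fderiv ℝ u x h =
      2 * ∫ t in Set.Ioi (0:ℝ),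
        Real.exp (-t / lam) *
          ((π * (1 - Real.exp (-2 * t))) ^ (-(m : ℝ) / 2) *
            ∫ y : EuclideanSpace ℝ (Fin m),
              ftil (Real.exp (-t) • x + y) *
                (Real.exp (-t) / (1 - Real.exp (-2 * t))) * ⟪h, y⟫ *
                  Real.exp (-‖y‖ ^ 2 / (1 - Real.exp (-2 * t)))) := by
    intro x
    rw [(hder x).fderiv, ContinuousLinearMap.integral_apply (hI2 x), ← integral_const_mul]
    refine setIntegral_congr_fun measurableSet_Ioi fun t ht => ?_
    have hs := aux_spos ht
    have hi := aux_wint hs (fun y => Real.exp (-t) • fderiv ℝ ftil (Real.exp (-t) • x + y))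
      (by fun_prop) (Real.exp (-t) * C) 0 (fun y => by
        rw [norm_smul, Real.norm_of_nonneg (Real.exp_pos _).le, zero_mul, add_zero]
        gcongr
        exact hC _)
    simp only [smul_apply, smul_eq_mul]
    rw [ContinuousLinearMap.integral_apply hi]
    simp only [smul_apply, smul_eq_mul]
    have hfd : ∀ y, fderiv ℝ (fun y => ftil (Real.exp (-t) • x + y)) y =
        fderiv ℝ ftil (Real.exp (-t) • x + y) := fun y => fderiv_comp_add_left _
    have key := aux_ibp hs h hh (fun y => ftil (Real.exp (-t) • x + y))
      (hF.comp (contDiff_const.add contDiff_id)) (lam⁻¹ * M) C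
      (fun y => by
        have h1 := hK (Real.exp (-t) • x + y)
        have h2 : 0 ≤ lam⁻¹ * M * ‖y‖ := by positivity
        linarith)
      (fun y => by rw [hfd]; exact hC _)
    simp only [hfd] at key
    have e1 : ∫ y : EuclideanSpace ℝ (Fin m), Real.exp (-‖y‖ ^ 2 / (1 - Real.exp (-2 * t))) *
        (Real.exp (-t) * fderiv ℝ ftil (Real.exp (-t) • x + y) h) =
        Real.exp (-t) * ∫ y : EuclideanSpace ℝ (Fin m), fderiv ℝ ftil (Real.exp (-t) • x + y) h *
          Real.exp (-‖y‖ ^ 2 / (1 - Real.exp (-2 * t))) := by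
      rw [← integral_const_mul]
      congr 1; ext y; ring
    have e2 : Real.exp (-t) * ∫ y : EuclideanSpace ℝ (Fin m), ftil (Real.exp (-t) • x + y) *
          (2 / (1 - Real.exp (-2 * t)) * ⟪h, y⟫) *
          Real.exp (-‖y‖ ^ 2 / (1 - Real.exp (-2 * t))) =
        2 * ∫ y : EuclideanSpace ℝ (Fin m), ftil (Real.exp (-t) • x + y) *
                (Real.exp (-t) / (1 - Real.exp (-2 * t))) * ⟪h, y⟫ *
                  Real.exp (-‖y‖ ^ 2 / (1 - Real.exp (-2 * t))) := by
      rw [← integral_const_mul, ← integral_const_mul]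
      congr 1; ext y; ring
    rw [e1, key, e2]
    ring
  refine ⟨hform, fun x => ?_⟩
  rw [hform x, abs_mul, abs_two]
  have hbound : ‖∫ t in Set.Ioi (0:ℝ),
        Real.exp (-t / lam) *
          ((π * (1 - Real.exp (-2 * t))) ^ (-(m : ℝ) / 2) *
            ∫ y : EuclideanSpace ℝ (Fin m),
              ftil (Real.exp (-t) • x + y) *
                (Real.exp (-t) / (1 - Real.exp (-2 * t))) * ⟪h, y⟫ *
                  Real.exp (-‖y‖ ^ 2 / (1 - Real.exp (-2 * t))))‖ ≤
      ∫ t in Set.Ioi (0:ℝ), (lam⁻¹ * M / √2) *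
        (Real.exp (-t) / √(1 - Real.exp (-2 * t))) := by
    apply norm_integral_le_of_norm_le (aux_arcsin.1.const_mul _)
    refine (ae_restrict_iff' measurableSet_Ioi).2 (Filter.Eventually.of_forall fun t ht => ?_)
    have hs := aux_spos ht
    have ht0 : 0 < t := ht
    set s := 1 - Real.exp (-2 * t) with hsdef
    have hi : Integrable (fun y : EuclideanSpace ℝ (Fin m) =>
        |⟪h, y⟫| * Real.exp (-‖y‖ ^ 2 / s)) := by
      have := aux_wint hs (fun y => |⟪h, y⟫|) (by fun_prop) 1 1 (fun y => by
        have h1 := aux_inner_sq_le h y hh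
        rw [Real.norm_eq_abs, abs_abs]
        nlinarith [sq_nonneg (‖y‖ - 1 / 2)])
      simpa [mul_comm] using this
    have h1 : ‖∫ y : EuclideanSpace ℝ (Fin m), ftil (Real.exp (-t) • x + y) *
        (Real.exp (-t) / s) * ⟪h, y⟫ * Real.exp (-‖y‖ ^ 2 / s)‖ ≤
        ∫ y : EuclideanSpace ℝ (Fin m), (lam⁻¹ * M * (Real.exp (-t) / s)) *
          (|⟪h, y⟫| * Real.exp (-‖y‖ ^ 2 / s)) := by
      apply norm_integral_le_of_norm_le (hi.const_mul _)
      refine Filter.Eventually.of_forall fun y => ?_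
      rw [norm_mul, norm_mul, norm_mul, Real.norm_of_nonneg (Real.exp_pos _).le,
        Real.norm_of_nonneg (by positivity : 0 ≤ Real.exp (-t) / s), Real.norm_eq_abs,
        Real.norm_eq_abs, mul_assoc (_ * _)]
      gcongr
      exact hK _
    rw [integral_const_mul] at h1
    have h2 := aux_abs hs h hh
    have hc0 : 0 ≤ (π * s) ^ (-(m : ℝ) / 2) := by positivity
    rw [norm_mul, norm_mul, Real.norm_of_nonneg (Real.exp_pos _).le, Real.norm_of_nonneg hc0]
    have hle : Real.exp (-t / lam) ≤ 1 := Real.exp_le_one_iff.2 (by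
      rw [neg_div]; have : 0 < t / lam := by positivity
      linarith)
    have h3 : (π * s) ^ (-(m : ℝ) / 2) * ‖∫ y : EuclideanSpace ℝ (Fin m),
        ftil (Real.exp (-t) • x + y) *
        (Real.exp (-t) / s) * ⟪h, y⟫ * Real.exp (-‖y‖ ^ 2 / s)‖ ≤
        (lam⁻¹ * M * (Real.exp (-t) / s)) * √(s / 2) := by
      calc _ ≤ (π * s) ^ (-(m : ℝ) / 2) * _ := mul_le_mul_of_nonneg_left h1 hc0
        _ = (lam⁻¹ * M * (Real.exp (-t) / s)) * ((π * s) ^ (-(m : ℝ) / 2) *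
          ∫ y : EuclideanSpace ℝ (Fin m), |⟪h, y⟫| * Real.exp (-‖y‖ ^ 2 / s)) := by ring
        _ ≤ _ := mul_le_mul_of_nonneg_left h2 (by positivity)
    have h4 : (lam⁻¹ * M * (Real.exp (-t) / s)) * √(s / 2) =
        (lam⁻¹ * M / √2) * (Real.exp (-t) / √s) := by
      rw [Real.sqrt_div hs.le]
      have h5 : s = √s * √s := (Real.mul_self_sqrt hs.le).symm
      have h6 : √s / s = 1 / √s := by
        rw [div_eq_div_iff hs.ne' (Real.sqrt_pos.2 hs).ne', one_mul, ← h5]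
      calc _ = lam⁻¹ * M * Real.exp (-t) / √2 * (√s / s) := by ring
        _ = _ := by rw [h6]; ring
    calc _ ≤ 1 * _ := mul_le_mul hle h3 (by positivity) zero_le_one
      _ = _ := by rw [one_mul, h4]
  rw [integral_const_mul, aux_arcsin.2, Real.norm_eq_abs] at hbound
  calc _ ≤ 2 * (lam⁻¹ * M / √2 * (π / 2)) := by linarith
    _ = _ := by field_simp

/-- Directional derivative formula and bound for the rescaled OU resolvent. -/
theorem stmt_13 (lam : ℝ) (hlam : 0 < lam) (m : ℕ) (hm : 1 ≤ m)
    (h : EuclideanSpace ℝ (Fin m)) (hh : ‖h‖ = 1)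
    (f : EuclideanSpace ℝ (Fin m) → ℝ)
    (hf : ContDiff ℝ 2 f)
    (hbd : ∀ i : ℕ, i ≤ 2 → ∃ M, ∀ x, ‖iteratedFDeriv ℝ i f x‖ ≤ M)
    (ftil : EuclideanSpace ℝ (Fin m) → ℝ)
    (hftil : ∀ x, ftil x = lam⁻¹ * f ((Real.sqrt lam)⁻¹ • x))
    (u : EuclideanSpace ℝ (Fin m) → ℝ)
    (hu : ∀ x, u x = ∫ t in Set.Ioi (0:ℝ),
      Real.exp (-t / lam) *
        ((π * (1 - Real.exp (-2 * t))) ^ (-(m : ℝ) / 2) *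
          ∫ y : EuclideanSpace ℝ (Fin m),
            ftil (Real.exp (-t) • x + y) *
              Real.exp (-‖y‖ ^ 2 / (1 - Real.exp (-2 * t)))))
    (M : ℝ) (hM : ∀ x, |f x| ≤ M) :
    (∀ x, fderiv ℝ u x h =
      2 * ∫ t in Set.Ioi (0:ℝ),
        Real.exp (-t / lam) *
          ((π * (1 - Real.exp (-2 * t))) ^ (-(m : ℝ) / 2) *
            ∫ y : EuclideanSpace ℝ (Fin m),
              ftil (Real.exp (-t) • x + y) *
                (Real.exp (-t) / (1 - Real.exp (-2 * t))) * ⟪h, y⟫ *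
                  Real.exp (-‖y‖ ^ 2 / (1 - Real.exp (-2 * t)))))
    ∧ ∀ x, |fderiv ℝ u x h| ≤ (π / (lam * Real.sqrt 2)) * M := by
  have hK : ∀ y, |ftil y| ≤ lam⁻¹ * M := fun y => by
    rw [hftil, abs_mul, abs_of_pos (inv_pos.2 hlam)]
    exact mul_le_mul_of_nonneg_left (hM _) (inv_pos.2 hlam).le
  have hM0 : 0 ≤ M := (abs_nonneg _).trans (hM 0)
  obtain ⟨C0, hC0⟩ := hbd 1 (by norm_num)
  have hF : ContDiff ℝ 1 ftil := by
    have : ftil = fun x => lam⁻¹ * f ((Real.sqrt lam)⁻¹ • x) := funext hftil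
    rw [this]
    have h1 : ContDiff ℝ 1 f := hf.of_le (by norm_num)
    exact contDiff_const.mul (h1.comp (contDiff_id.const_smul _))
  obtain ⟨C, hC⟩ : ∃ C, ∀ y, ‖fderiv ℝ ftil y‖ ≤ C := by
    refine ⟨|lam⁻¹| * (|(Real.sqrt lam)⁻¹| * C0), fun y => ?_⟩
    have e : ftil = fun x => lam⁻¹ * f ((Real.sqrt lam)⁻¹ • x) := funext hftil
    have h1 : HasFDerivAt (fun x : EuclideanSpace ℝ (Fin m) => (Real.sqrt lam)⁻¹ • x)
        ((Real.sqrt lam)⁻¹ • ContinuousLinearMap.id ℝ _) y := (hasFDerivAt_id y).const_smul (Real.sqrt lam)⁻¹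
    have h2 := ((hf.differentiable (by norm_num)
      ((Real.sqrt lam)⁻¹ • y)).hasFDerivAt.comp y h1).const_mul lam⁻¹
    have h3 := (show HasFDerivAt (fun x => lam⁻¹ * f ((Real.sqrt lam)⁻¹ • x)) _ y from h2)
    rw [← e] at h3
    rw [h3.fderiv, ContinuousLinearMap.comp_smul, ContinuousLinearMap.comp_id, norm_smul, norm_smul,
      Real.norm_eq_abs, Real.norm_eq_abs]
    gcongr
    rw [← norm_iteratedFDeriv_one]
    exact hC0 _
  exact aux_main hlam h hh ftil hF C hK hC u hu hM0
end
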